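/- Let ξ ∈ (0,1) and let λ, ρ be degree distributions satisfying the successful decoding condition ξ·λ(1−ρ(1−x)) < x for all x ∈ (0, ξ]. Define the density-evolution iterates P^{(0)} = ξ and P^{(l)} = ξ·λ(1−ρ(1−P^{(l−1)})) for l ≥ 1. Then the sequence (P^{(l)}) is strictly decreasing as long as it is positive and converges to 0; consequently, for every η ∈ (0, ξ) the set { l : P^{(l)} > η } is finite and nonempty, so the decoding convergence time T_η = max{ l : P^{(l)} > η } is a well-defined finite natural number. -/

import Mathlib

open scoped BigOperators

/-- A degree distribution: a real polynomial `γ(x) = ∑_{i=2}^{D} γ_i x^(i-1)` whose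
coefficients are nonnegative and sum to `1`; `D` (the largest index with `γ_D ≠ 0`)
is called the maximal degree. -/
structure DegreeDist where
  c : ℕ → ℝ
  D : ℕ
  two_le_D : 2 ≤ D
  nonneg : ∀ i, 0 ≤ c i
  supp : ∀ i, c i ≠ 0 → 2 ≤ i ∧ i ≤ D
  cD_ne : c D ≠ 0
  sum_eq_one : ∑ i ∈ Finset.Icc 2 D, c i = 1

/-- Evaluation of a degree distribution at a real `x`. -/
noncomputable def DegreeDist.eval (γ : DegreeDist) (x : ℝ) : ℝ :=
  ∑ i ∈ Finset.Icc 2 γ.D, γ.c i * x ^ (i - 1)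

namespace DegreeDist

theorem eval_nonneg (γ : DegreeDist) {x : ℝ} (hx : 0 ≤ x) : 0 ≤ γ.eval x :=
  Finset.sum_nonneg fun i _ => mul_nonneg (γ.nonneg i) (pow_nonneg hx _)

theorem eval_le_one (γ : DegreeDist) {x : ℝ} (hx₀ : 0 ≤ x) (hx₁ : x ≤ 1) : γ.eval x ≤ 1 := by
  rw [← γ.sum_eq_one]
  exact Finset.sum_le_sum fun i _ => mul_le_of_le_one_right (γ.nonneg i) (pow_le_one₀ hx₀ hx₁)

theorem eval_one (γ : DegreeDist) : γ.eval 1 = 1 := by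
  simpa [eval] using γ.sum_eq_one

theorem eval_zero (γ : DegreeDist) : γ.eval 0 = 0 := by
  refine Finset.sum_eq_zero fun i hi => ?_
  have h : i - 1 ≠ 0 := by have := (Finset.mem_Icc.mp hi).1; omega
  rw [zero_pow h, mul_zero]

theorem continuous_eval (γ : DegreeDist) : Continuous γ.eval := by
  unfold eval
  fun_prop

end DegreeDist

/-- under the successful decoding condition the density-evolution
iterates are strictly decreasing while positive and tend to `0`; hence for every
`η ∈ (0, ξ)` the set `{l | P⁽ˡ⁾ > η}` is finite and nonempty (so the decoding
convergence time `T_η = max {l | P⁽ˡ⁾ > η}` is well defined). -/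
theorem stmt14 (ξ : ℝ) (hξ : ξ ∈ Set.Ioo (0:ℝ) 1) (lam ρ : DegreeDist)
    (hdec : ∀ x ∈ Set.Ioc (0:ℝ) ξ, ξ * lam.eval (1 - ρ.eval (1 - x)) < x)
    (P : ℕ → ℝ) (hP0 : P 0 = ξ)
    (hPs : ∀ l, P (l + 1) = ξ * lam.eval (1 - ρ.eval (1 - P l))) :
    (∀ l, 0 < P l → P (l + 1) < P l) ∧
      Filter.Tendsto P Filter.atTop (nhds 0) ∧
      ∀ η ∈ Set.Ioo (0:ℝ) ξ, {l : ℕ | η < P l}.Finite ∧ {l : ℕ | η < P l}.Nonempty := by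
  obtain ⟨hξ₀, hξ₁⟩ := hξ
  have step (l : ℕ) (h₀ : 0 ≤ P l) (h₁ : P l ≤ ξ) : 0 ≤ P (l + 1) ∧ P (l + 1) ≤ P l := by
    rw [hPs l]
    constructor
    · have := ρ.eval_le_one (x := 1 - P l) (by linarith) (by linarith)
      exact mul_nonneg hξ₀.le (lam.eval_nonneg (by linarith))
    · rcases h₀.eq_or_lt with h | h
      · simp [← h, ρ.eval_one, lam.eval_zero]
      · exact (hdec _ ⟨h, h₁⟩).le
  have bounds (l : ℕ) : 0 ≤ P l ∧ P l ≤ ξ := by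
    induction l with
    | zero => exact ⟨hP0 ▸ hξ₀.le, hP0.le⟩
    | succ l ih =>
      obtain ⟨h₀, h₁⟩ := step l ih.1 ih.2
      exact ⟨h₀, h₁.trans ih.2⟩
  have anti : Antitone P := antitone_nat_of_succ_le fun l => (step l (bounds l).1 (bounds l).2).2
  have lim : Filter.Tendsto P Filter.atTop (nhds 0) := by
    have hL := tendsto_atTop_ciInf anti ⟨0, Set.forall_mem_range.mpr fun l => (bounds l).1⟩
    set L := ⨅ l, P l
    have hL₀ : 0 ≤ L := ge_of_tendsto' hL fun l => (bounds l).1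
    have hL₁ : L ≤ ξ := le_of_tendsto' hL fun l => (bounds l).2
    have hcont : Continuous fun x => ξ * lam.eval (1 - ρ.eval (1 - x)) := by
      have := lam.continuous_eval
      have := ρ.continuous_eval
      fun_prop
    have hfix : L = ξ * lam.eval (1 - ρ.eval (1 - L)) := by
      refine tendsto_nhds_unique (hL.comp (Filter.tendsto_add_atTop_nat 1)) ?_
      refine ((hcont.tendsto L).comp hL).congr fun l => ?_
      exact (hPs l).symm
    rcases hL₀.eq_or_lt with h | h
    · rwa [← h] at hL
    · exact absurd hfix (hdec L ⟨h, hL₁⟩).ne'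
  refine ⟨fun l hl => ?_, lim, fun η hη => ⟨?_, 0, ?_⟩⟩
  · rw [hPs l]
    exact hdec _ ⟨hl, (bounds l).2⟩
  · obtain ⟨N, hN⟩ := Filter.eventually_atTop.mp (lim.eventually_lt_const hη.1)
    refine (Set.finite_lt_nat N).subset fun l hl => ?_
    by_contra h
    exact lt_asymm hl (hN l (not_lt.mp h))
  · simpa [hP0] using hη.2
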